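/- arXiv:1509.09188 — 2 statements merged into one kernel-verified Lean document; each statement's English description precedes it below -/
import Mathlib

section
/- If Ψ = 20^4·k^3/δ for some δ ∈ (0,1], then for every i ∈ {1,…,k} the estimation center p^{(i)} satisfies (1 − √δ/4)/μ(P_i) ≤ ‖p^{(i)}‖^2 ≤ (1 + √δ/4)/μ(P_i). -/
open Finset BigOperators Matrix

namespace SpectralClustering

variable {V : Type} [Fintype V] [DecidableEq V]

/-- Volume of a vertex set: the sum of the degrees of its vertices. -/
def vol (G : SimpleGraph V) [DecidableRel G.Adj] (S : Finset V) : ℕ :=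
  ∑ v ∈ S, G.degree v

/-- Number of edges between two (disjoint) vertex sets. -/
def cut (G : SimpleGraph V) [DecidableRel G.Adj] (S T : Finset V) : ℕ :=
  ∑ u ∈ S, (T.filter fun v => G.Adj u v).card

/-- Conductance `φ(S) = |E(S, V \ S)| / μ(S)`. -/
noncomputable def conductance (G : SimpleGraph V) [DecidableRel G.Adj] (S : Finset V) : ℝ :=
  (cut G S Sᶜ : ℝ) / (vol G S : ℝ)

/-- A `k`-way partition of the vertex set into nonempty blocks. -/
def IsKWayPartition {k : ℕ} (P : Fin k → Finset V) : Prop :=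
  (∀ i, (P i).Nonempty) ∧ (∀ i j, i ≠ j → Disjoint (P i) (P j)) ∧
    (∀ v : V, ∃ i, v ∈ P i)

/-- Maximum conductance over the blocks of a tuple of sets. -/
noncomputable def maxCond (G : SimpleGraph V) [DecidableRel G.Adj] {k : ℕ}
    (P : Fin k → Finset V) : ℝ :=
  ⨆ i, conductance G (P i)

/-- Average conductance of the blocks. -/
noncomputable def avgCond (G : SimpleGraph V) [DecidableRel G.Adj] {k : ℕ}
    (P : Fin k → Finset V) : ℝ :=
  (∑ i, conductance G (P i)) / (k : ℝ)

/-- `P` achieves `ρ̂_avr(k)`: it minimizes the maximum conductance among all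
`k`-way partitions, and among those it has minimal average conductance. -/
def AchievesRhoAvr (G : SimpleGraph V) [DecidableRel G.Adj] {k : ℕ}
    (P : Fin k → Finset V) : Prop :=
  IsKWayPartition P ∧
  (∀ Q : Fin k → Finset V, IsKWayPartition Q → maxCond G P ≤ maxCond G Q) ∧
  (∀ Q : Fin k → Finset V, IsKWayPartition Q → maxCond G Q = maxCond G P →
    avgCond G P ≤ avgCond G Q)

/-- Dot product of two vectors indexed by the vertices. -/
def dotV (x y : V → ℝ) : ℝ := ∑ v, x v * y v

/-- The normalized Laplacian `I - D^{-1/2} A D^{-1/2}`. -/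
noncomputable def normLap (G : SimpleGraph V) [DecidableRel G.Adj] : Matrix V V ℝ :=
  1 - Matrix.diagonal (fun v => (Real.sqrt (G.degree v))⁻¹) * G.adjMatrix ℝ *
      Matrix.diagonal (fun v => (Real.sqrt (G.degree v))⁻¹)

/-- `f` is an orthonormal family of eigenvectors of the normalized Laplacian of `G`
with (sorted) eigenvalues `lam`. -/
structure EigenData (G : SimpleGraph V) [DecidableRel G.Adj]
    (f : Fin (Fintype.card V) → V → ℝ) (lam : Fin (Fintype.card V) → ℝ) : Prop where
  eig : ∀ i, (normLap G).mulVec (f i) = lam i • f i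
  ortho : ∀ i j, dotV (f i) (f j) = if i = j then (1 : ℝ) else 0
  mono : Monotone lam

/-- The gap parameter `Ψ = λ_{k+1} / ρ̂_avr(k)`, where `ρ̂_avr(k)` is realized as the
average conductance of the fixed optimal partition `P`. -/
noncomputable def Psi (G : SimpleGraph V) [DecidableRel G.Adj]
    (lam : Fin (Fintype.card V) → ℝ) {k : ℕ} (P : Fin k → Finset V)
    (hkn : k < Fintype.card V) : ℝ :=
  lam ⟨k, hkn⟩ / avgCond G P

/-- The spectral embedding `F(u) = d_u^{-1/2} (f_1(u), …, f_k(u))`. -/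
noncomputable def Femb (G : SimpleGraph V) [DecidableRel G.Adj]
    (f : Fin (Fintype.card V) → V → ℝ) {k : ℕ} (hk : k ≤ Fintype.card V) (u : V) :
    Fin k → ℝ :=
  fun j => f (Fin.castLE hk j) u / Real.sqrt (G.degree u)

/-- `k`-means cost of a clustering of the (degree-weighted) spectral embedding:
`∑_i ∑_{u ∈ A_i} d_u ‖F(u) - c_i‖²`. -/
noncomputable def kmCost (G : SimpleGraph V) [DecidableRel G.Adj]
    (f : Fin (Fintype.card V) → V → ℝ) {k : ℕ} (hk : k ≤ Fintype.card V) {ℓ : ℕ}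
    (A : Fin ℓ → Finset V) (c : Fin ℓ → Fin k → ℝ) : ℝ :=
  ∑ i, ∑ u ∈ A i, (G.degree u : ℝ) * ∑ j, (Femb G f hk u j - c i j) ^ 2

/-- `Δ_ℓ(𝒳_V)`: the optimal `ℓ`-means cost of the spectral embedding multiset `𝒳_V`
(which contains `d_u` copies of `F(u)` for every vertex `u`). -/
noncomputable def kmOpt (G : SimpleGraph V) [DecidableRel G.Adj]
    (f : Fin (Fintype.card V) → V → ℝ) {k : ℕ} (hk : k ≤ Fintype.card V) (ℓ : ℕ) : ℝ :=
  sInf { r : ℝ | ∃ (A : Fin ℓ → Finset V) (c : Fin ℓ → Fin k → ℝ),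
    (∀ i j, i ≠ j → Disjoint (A i) (A j)) ∧ (∀ v : V, ∃ i, v ∈ A i) ∧
    r = kmCost G f hk A c }

/-- Normalized characteristic vector `ḡ_i = D^{1/2} χ_{P_i} / √μ(P_i)`. -/
noncomputable def gbar (G : SimpleGraph V) [DecidableRel G.Adj] {k : ℕ}
    (P : Fin k → Finset V) (i : Fin k) : V → ℝ :=
  fun v => (if v ∈ P i then Real.sqrt (G.degree v) else 0) / Real.sqrt (vol G (P i))

/-- Coefficients `α_j^{(i)} = ⟨ḡ_i, f_j⟩` of `ḡ_i` in the eigenbasis. -/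
noncomputable def alpha (G : SimpleGraph V) [DecidableRel G.Adj] {k : ℕ}
    (P : Fin k → Finset V) (f : Fin (Fintype.card V) → V → ℝ)
    (i : Fin k) (j : Fin (Fintype.card V)) : ℝ :=
  dotV (gbar G P i) (f j)

/-- Projection `f̂_i = ∑_{j=1}^k α_j^{(i)} f_j` of `ḡ_i` onto the first `k` eigenvectors. -/
noncomputable def fhat (G : SimpleGraph V) [DecidableRel G.Adj] {k : ℕ}
    (P : Fin k → Finset V) (f : Fin (Fintype.card V) → V → ℝ) (i : Fin k) : V → ℝ :=
  fun v => ∑ j : Fin (Fintype.card V),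
    if (j : ℕ) < k then alpha G P f i j * f j v else 0

/-- Estimation center `p^{(i)} = μ(P_i)^{-1/2} (β_i^{(1)}, …, β_i^{(k)})`;
here `beta i j` denotes `β_j^{(i)}`. -/
noncomputable def estCenter (G : SimpleGraph V) [DecidableRel G.Adj] {k : ℕ}
    (P : Fin k → Finset V) (beta : Fin k → Fin k → ℝ) (i : Fin k) : Fin k → ℝ :=
  fun j => beta j i / Real.sqrt (vol G (P i))

theorem vecMul_dotProduct_self {ι κ : Type*} [Fintype ι] [Fintype κ]
    (y : ι → ℝ) (M : Matrix ι κ ℝ) : (y ᵥ* M) ⬝ᵥ (y ᵥ* M) = (y ᵥ* (M * Mᵀ)) ⬝ᵥ y := by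
  rw [← Matrix.vecMul_vecMul, Matrix.vecMul_transpose, dotProduct_comm _ y,
    Matrix.dotProduct_mulVec]

/-- If `A Aᵀ + B Bᵀ = 1` and `B` has squared Frobenius norm at most `ε`, then the columns of a
left inverse of `A` have squared norm between `1` and `1 / (1 - ε)`. -/
theorem col_sq_sum_of_left_inverse {ι κ : Type*} [Fintype ι] [DecidableEq ι] [Fintype κ]
    (A β : Matrix ι ι ℝ) (B : Matrix ι κ ℝ) (ε : ℝ) (hε : ε ≤ 1)
    (hAB : A * Aᵀ + B * Bᵀ = 1) (hB : ∑ i, ∑ j, B i j ^ 2 ≤ ε) (hβ : β * A = 1) (i : ι) :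
    1 ≤ ∑ j, β j i ^ 2 ∧ (1 - ε) * ∑ j, β j i ^ 2 ≤ 1 := by
  have hAβ : A * β = 1 := mul_eq_one_comm.mp hβ
  set b : ι → ℝ := fun j => β j i with hb
  set y : ι → ℝ := b ᵥ* β with hy
  have hyA : y ᵥ* A = b := by rw [hy, Matrix.vecMul_vecMul, hβ, Matrix.vecMul_one]
  have hs : ∑ j, β j i ^ 2 = b ⬝ᵥ b := by simp [dotProduct, hb, sq]
  have hAb : A *ᵥ b = Pi.single i 1 := by
    ext l
    have := congrFun (congrFun hAβ l) i
    simpa [Matrix.mul_apply, Matrix.mulVec, dotProduct, Matrix.one_apply, Pi.single_apply, hb]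
      using this
  have hsy : b ⬝ᵥ b = y i := by
    calc b ⬝ᵥ b = (y ᵥ* A) ⬝ᵥ b := by rw [hyA]
      _ = y ⬝ᵥ (A *ᵥ b) := (Matrix.dotProduct_mulVec _ _ _).symm
      _ = y i := by rw [hAb]; simp
  have hlow : 1 ≤ b ⬝ᵥ b := by
    have h1 : (∑ l, A i l * b l) = 1 := by
      have := congrFun hAb i
      simpa [Matrix.mulVec, dotProduct] using this
    have h2 : ∑ l, A i l ^ 2 ≤ 1 := by
      have := congrFun (congrFun hAB i) i
      simp only [Matrix.add_apply, Matrix.mul_apply, Matrix.transpose_apply, Matrix.one_apply_eq,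
        ← sq] at this
      have : 0 ≤ ∑ l, B i l ^ 2 := by positivity
      linarith
    have h3 := Finset.sum_mul_sq_le_sq_mul_sq Finset.univ (A i) b
    have h4 : ∑ l, b l ^ 2 = b ⬝ᵥ b := hs
    have h5 : 0 ≤ ∑ l, b l ^ 2 := by positivity
    rw [h1, h4] at h3
    rw [h4] at h5
    nlinarith
  have hnorm : (y ᵥ* A) ⬝ᵥ (y ᵥ* A) + (y ᵥ* B) ⬝ᵥ (y ᵥ* B) = y ⬝ᵥ y := by
    rw [vecMul_dotProduct_self, vecMul_dotProduct_self, ← add_dotProduct, ← Matrix.vecMul_add, hAB, Matrix.vecMul_one]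
  have hBy : (y ᵥ* B) ⬝ᵥ (y ᵥ* B) ≤ (y ⬝ᵥ y) * ε := by
    have hyy : ∑ l, y l ^ 2 = y ⬝ᵥ y := by simp [dotProduct, sq]
    have hy0 : 0 ≤ y ⬝ᵥ y := by rw [← hyy]; positivity
    calc (y ᵥ* B) ⬝ᵥ (y ᵥ* B) = ∑ j, (∑ l, y l * B l j) ^ 2 := by
          simp [dotProduct, Matrix.vecMul, sq]
      _ ≤ ∑ j, (∑ l, y l ^ 2) * ∑ l, B l j ^ 2 :=
          Finset.sum_le_sum fun j _ =>
            Finset.sum_mul_sq_le_sq_mul_sq Finset.univ y fun l => B l j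
      _ = (y ⬝ᵥ y) * ∑ l, ∑ j, B l j ^ 2 := by
          rw [← Finset.mul_sum, Finset.sum_comm, hyy]
      _ ≤ _ := mul_le_mul_of_nonneg_left hB hy0
  have hyi : y i ^ 2 ≤ y ⬝ᵥ y := by
    have := Finset.single_le_sum (f := fun l => y l ^ 2) (fun l _ => sq_nonneg _)
      (Finset.mem_univ i)
    simpa [dotProduct, sq] using this
  rw [hs]
  refine ⟨hlow, ?_⟩
  rw [hyA] at hnorm
  rw [← hsy] at hyi
  have h : (b ⬝ᵥ b) * ((1 - ε) * (b ⬝ᵥ b)) ≤ (b ⬝ᵥ b) * 1 := by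
    have := mul_le_mul_of_nonneg_left hyi (sub_nonneg.mpr hε)
    nlinarith
  exact le_of_mul_le_mul_left h (by linarith)

theorem sum_castLE_eq_sum_ite {k n : ℕ} (hk : k ≤ n) (g : Fin n → ℝ) :
    ∑ l : Fin k, g (Fin.castLE hk l) = ∑ j : Fin n, if (j : ℕ) < k then g j else 0 := by
  rw [← Finset.sum_filter]
  refine Finset.sum_bij (fun l _ => Fin.castLE hk l) ?_ ?_ ?_ ?_
  · intro l _
    simp
  · intro a _ b _ h
    exact Fin.castLE_injective hk h
  · intro j hj
    exact ⟨⟨j, (Finset.mem_filter.mp hj).2⟩, Finset.mem_univ _, rfl⟩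
  · intro l _
    rfl

/-- Quadratic form of the normalized Laplacian in the degree-rescaled coordinates. -/
theorem dotV_normLap_mulVec (G : SimpleGraph V) [DecidableRel G.Adj]
    (hd : ∀ v : V, 0 < G.degree v) (y : V → ℝ) :
    dotV (fun v => √(G.degree v) * y v)
        ((normLap G).mulVec fun v => √(G.degree v) * y v) =
      ∑ u, ∑ v, if G.Adj u v then y u ^ 2 - y u * y v else 0 := by
  have hs (v : V) : √(G.degree v : ℝ) ≠ 0 :=
    (Real.sqrt_pos.mpr (by exact_mod_cast hd v)).ne'
  have hsq (v : V) : √(G.degree v : ℝ) ^ 2 = G.degree v := Real.sq_sqrt (by positivity)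
  have hentry (u : V) : (normLap G).mulVec (fun v => √(G.degree v) * y v) u =
      √(G.degree u) * y u - (√(G.degree u))⁻¹ * ∑ v, if G.Adj u v then y v else 0 := by
    rw [normLap, Matrix.sub_mulVec, Matrix.one_mulVec, Pi.sub_apply]
    congr 1
    rw [Matrix.mulVec, dotProduct, Finset.mul_sum]
    refine Finset.sum_congr rfl fun v _ => ?_
    rw [Matrix.mul_diagonal, Matrix.diagonal_mul, SimpleGraph.adjMatrix_apply]
    have := hs v
    split_ifs
    · field_simp
    · simp
  refine Finset.sum_congr rfl fun u _ => ?_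
  have hdeg : ∑ v, (if G.Adj u v then y u ^ 2 else 0) = G.degree u * y u ^ 2 := by
    rw [← Finset.sum_filter, Finset.sum_const, nsmul_eq_mul, ← SimpleGraph.neighborFinset_eq_filter,
      SimpleGraph.card_neighborFinset_eq_degree]
  have hsplit : ∑ v, (if G.Adj u v then y u ^ 2 - y u * y v else 0) =
      G.degree u * y u ^ 2 - y u * ∑ v, if G.Adj u v then y v else 0 := by
    rw [← hdeg, Finset.mul_sum, ← Finset.sum_sub_distrib]
    refine Finset.sum_congr rfl fun v _ => ?_
    split_ifs <;> simp
  rw [hsplit, hentry]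
  have hinv : √(G.degree u : ℝ) * (√(G.degree u))⁻¹ = 1 := mul_inv_cancel₀ (hs u)
  linear_combination y u ^ 2 * hsq u - (y u * ∑ v, if G.Adj u v then y v else 0) * hinv

theorem dotV_normLap_mulVec_nonneg (G : SimpleGraph V) [DecidableRel G.Adj]
    (hd : ∀ v : V, 0 < G.degree v) (x : V → ℝ) : 0 ≤ dotV x ((normLap G).mulVec x) := by
  have hx : x = fun v => √(G.degree v) * (x v / √(G.degree v)) := by
    ext v
    have : √(G.degree v : ℝ) ≠ 0 := (Real.sqrt_pos.mpr (by exact_mod_cast hd v)).ne'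
    field_simp
  obtain ⟨y, rfl⟩ : ∃ y : V → ℝ, x = fun v => √(G.degree v) * y v := ⟨_, hx⟩
  rw [dotV_normLap_mulVec G hd]
  set S := ∑ u, ∑ v, if G.Adj u v then y u ^ 2 - y u * y v else 0 with hS
  have hswap : S = ∑ u, ∑ v, if G.Adj u v then y v ^ 2 - y v * y u else 0 := by
    rw [hS, Finset.sum_comm]
    simp only [G.adj_comm]
  have hsum : S + S = ∑ u, ∑ v, if G.Adj u v then (y u - y v) ^ 2 else 0 := by
    nth_rewrite 2 [hswap]
    rw [hS, ← Finset.sum_add_distrib]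
    refine Finset.sum_congr rfl fun u _ => ?_
    rw [← Finset.sum_add_distrib]
    refine Finset.sum_congr rfl fun v _ => ?_
    split_ifs <;> ring
  have : 0 ≤ S + S := by
    rw [hsum]
    refine Finset.sum_nonneg fun u _ => Finset.sum_nonneg fun v _ => ?_
    split_ifs <;> positivity
  linarith

theorem vol_pos {W : Type} [Fintype W] (G : SimpleGraph W) [DecidableRel G.Adj]
    (hd : ∀ v : W, 0 < G.degree v) {S : Finset W} (hS : S.Nonempty) : 0 < vol G S :=
  Finset.sum_pos (fun v _ => hd v) hS

theorem dotV_gbar_normLap (G : SimpleGraph V) [DecidableRel G.Adj]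
    (hd : ∀ v : V, 0 < G.degree v) {k : ℕ} (P : Fin k → Finset V) (i : Fin k) :
    dotV (gbar G P i) ((normLap G).mulVec (gbar G P i)) = conductance G (P i) := by
  have hg : gbar G P i = fun v => √(G.degree v) *
      ((if v ∈ P i then 1 else 0) / √(vol G (P i))) := by
    ext v
    simp only [gbar]
    split_ifs <;> simp [div_eq_mul_inv]
  have hv : √(vol G (P i) : ℝ) ^ 2 = vol G (P i) := Real.sq_sqrt (by positivity)
  rw [hg, dotV_normLap_mulVec G hd, conductance, cut]
  push_cast
  rw [Finset.sum_div, ← Finset.sum_subset (Finset.subset_univ (P i))]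
  · refine Finset.sum_congr rfl fun u hu => ?_
    rw [Finset.card_filter, ← Finset.sum_subset (Finset.subset_univ (P i)ᶜ)]
    · push_cast
      rw [Finset.sum_div]
      refine Finset.sum_congr rfl fun v hv' => ?_
      rw [Finset.mem_compl] at hv'
      split_ifs <;> simp [hv]
    · intro v _ hv'
      rw [Finset.mem_compl, not_not] at hv'
      simp [hu, hv', sq]
  · intro u _ hu
    simp [hu]

theorem dotV_gbar (G : SimpleGraph V) [DecidableRel G.Adj]
    (hd : ∀ v : V, 0 < G.degree v) {k : ℕ} {P : Fin k → Finset V} (hP : IsKWayPartition P)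
    (i j : Fin k) : dotV (gbar G P i) (gbar G P j) = if i = j then 1 else 0 := by
  split_ifs with hij
  · subst hij
    have hpos : (0 : ℝ) < vol G (P i) := by exact_mod_cast vol_pos G hd (hP.1 i)
    have hv : √(vol G (P i) : ℝ) ^ 2 = vol G (P i) := Real.sq_sqrt hpos.le
    calc dotV (gbar G P i) (gbar G P i)
        = ∑ v, (if v ∈ P i then (G.degree v : ℝ) else 0) / vol G (P i) := by
          refine Finset.sum_congr rfl fun v _ => ?_
          have hdv : √(G.degree v : ℝ) ^ 2 = G.degree v := Real.sq_sqrt (by positivity)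
          rw [← sq, gbar, div_pow, hv]
          split_ifs <;> simp
      _ = 1 := by
          rw [← Finset.sum_div, Finset.sum_ite_mem, Finset.univ_inter, div_eq_one_iff_eq hpos.ne',
            vol]
          push_cast
          rfl
  · refine Finset.sum_eq_zero fun v _ => ?_
    have := Finset.disjoint_left.mp (hP.2.1 i j hij)
    by_cases h : v ∈ P i
    · simp [gbar, this h]
    · simp [gbar, h]

namespace EigenData

variable {G : SimpleGraph V} [DecidableRel G.Adj] {f : Fin (Fintype.card V) → V → ℝ}
  {lam : Fin (Fintype.card V) → ℝ}

/-- Parseval's identity for the eigenbasis. -/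
theorem sum_dotV_mul_dotV (hf : EigenData G f lam) (x y : V → ℝ) :
    ∑ j, dotV x (f j) * dotV y (f j) = dotV x y := by
  let F : Matrix (Fin (Fintype.card V)) V ℝ := Matrix.of f
  have h1 : F * Fᵀ = 1 := by
    ext i j
    rw [Matrix.one_apply, ← hf.ortho i j]
    rfl
  have h2 : Fᵀ * F = 1 :=
    (Matrix.mul_eq_one_comm_of_card_eq _ _ _ (Fintype.card_fin _)).mp h1
  calc ∑ j, dotV x (f j) * dotV y (f j) = (x ᵥ* Fᵀ) ⬝ᵥ (y ᵥ* Fᵀ) := rfl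
    _ = x ⬝ᵥ y := by
      rw [← Matrix.dotProduct_mulVec, Matrix.vecMul_transpose, Matrix.mulVec_mulVec, h2,
        Matrix.one_mulVec]
    _ = dotV x y := rfl

theorem lam_nonneg (hf : EigenData G f lam) (hd : ∀ v : V, 0 < G.degree v)
    (j : Fin (Fintype.card V)) : 0 ≤ lam j := by
  have h := dotV_normLap_mulVec_nonneg G hd (f j)
  have h1 : dotV (f j) (lam j • f j) = lam j * dotV (f j) (f j) := by
    simp only [dotV, Finset.mul_sum, Pi.smul_apply, smul_eq_mul]
    exact Finset.sum_congr rfl fun v _ => by ring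
  rw [hf.eig, h1, hf.ortho] at h
  simpa using h

theorem sum_lam_mul_sq (hf : EigenData G f lam) (x : V → ℝ) :
    ∑ j, lam j * dotV x (f j) ^ 2 = dotV x ((normLap G).mulVec x) := by
  have hsymm : (normLap G)ᵀ = normLap G := by
    simp [normLap, Matrix.transpose_mul, Matrix.mul_assoc]
  have hL (j) : dotV ((normLap G).mulVec x) (f j) = lam j * dotV x (f j) := by
    calc dotV ((normLap G).mulVec x) (f j) = ((normLap G) *ᵥ x) ⬝ᵥ f j := rfl
      _ = x ⬝ᵥ ((normLap G) *ᵥ f j) := by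
        rw [Matrix.dotProduct_mulVec, ← Matrix.mulVec_transpose, hsymm]
      _ = lam j * dotV x (f j) := by
        rw [hf.eig, dotProduct_smul]
        rfl
  rw [← hf.sum_dotV_mul_dotV]
  exact Finset.sum_congr rfl fun j _ => by rw [hL]; ring

/-- The coefficients of `ḡ_i` beyond the first `k` are controlled by the conductance of `P_i`. -/
theorem lam_mul_sum_tail_le (hf : EigenData G f lam) (hd : ∀ v : V, 0 < G.degree v) {k : ℕ}
    (hkn : k < Fintype.card V) (P : Fin k → Finset V) (i : Fin k) :
    lam ⟨k, hkn⟩ * ∑ j : Fin (Fintype.card V),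
        (if (j : ℕ) < k then 0 else alpha G P f i j) ^ 2 ≤ conductance G (P i) := by
  rw [← dotV_gbar_normLap G hd, ← hf.sum_lam_mul_sq, Finset.mul_sum]
  refine Finset.sum_le_sum fun j _ => ?_
  split_ifs with hj
  · have := hf.lam_nonneg hd j
    simp only [ne_eq, OfNat.ofNat_ne_zero, not_false_eq_true, zero_pow, mul_zero]
    positivity
  · exact mul_le_mul_of_nonneg_right (hf.mono (Fin.le_def.mpr (not_lt.mp hj))) (sq_nonneg _)

end EigenData

/-- The coefficient matrix `β` is a left inverse of the matrix of leading coefficients. -/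
theorem beta_mul_alpha {G : SimpleGraph V} [DecidableRel G.Adj]
    {f : Fin (Fintype.card V) → V → ℝ} {lam : Fin (Fintype.card V) → ℝ}
    (hf : EigenData G f lam) {k : ℕ} (hk : k ≤ Fintype.card V) (P : Fin k → Finset V)
    (beta : Fin k → Fin k → ℝ)
    (hbeta : ∀ i : Fin k,
      f (Fin.castLE hk i) = fun v => ∑ j : Fin k, beta i j * fhat G P f j v) :
    Matrix.of beta * Matrix.of (fun i l => alpha G P f i (Fin.castLE hk l)) = 1 := by
  have hfhat (i l : Fin k) : dotV (fhat G P f i) (f (Fin.castLE hk l)) =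
      alpha G P f i (Fin.castLE hk l) := by
    calc dotV (fhat G P f i) (f (Fin.castLE hk l))
        = ∑ m : Fin k, alpha G P f i (Fin.castLE hk m) *
            dotV (f (Fin.castLE hk m)) (f (Fin.castLE hk l)) := by
          simp only [dotV, fhat, Finset.mul_sum]
          rw [Finset.sum_comm]
          refine Finset.sum_congr rfl fun v _ => ?_
          rw [← sum_castLE_eq_sum_ite hk fun j => alpha G P f i j * f j v, Finset.sum_mul]
          exact Finset.sum_congr rfl fun m _ => by ring
      _ = _ := by simp [hf.ortho]
  ext i l
  rw [Matrix.mul_apply]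
  simp only [Matrix.of_apply]
  calc ∑ j, beta i j * alpha G P f j (Fin.castLE hk l)
      = dotV (fun v => ∑ j : Fin k, beta i j * fhat G P f j v) (f (Fin.castLE hk l)) := by
        simp only [← hfhat, dotV, Finset.mul_sum, Finset.sum_mul]
        rw [Finset.sum_comm]
        exact Finset.sum_congr rfl fun v _ => Finset.sum_congr rfl fun j _ => by ring
    _ = (1 : Matrix (Fin k) (Fin k) ℝ) i l := by
        rw [← hbeta i, hf.ortho, Matrix.one_apply]
        simp

/-- Gram matrix identity for the coefficients, split into leading and trailing parts. -/
theorem alpha_mul_transpose_add {G : SimpleGraph V} [DecidableRel G.Adj]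
    (hd : ∀ v : V, 0 < G.degree v)
    {f : Fin (Fintype.card V) → V → ℝ} {lam : Fin (Fintype.card V) → ℝ}
    (hf : EigenData G f lam) {k : ℕ} (hk : k ≤ Fintype.card V) {P : Fin k → Finset V}
    (hP : IsKWayPartition P) :
    let A : Matrix (Fin k) (Fin k) ℝ := Matrix.of fun i l => alpha G P f i (Fin.castLE hk l)
    let B : Matrix (Fin k) (Fin (Fintype.card V)) ℝ :=
      Matrix.of fun i j => if (j : ℕ) < k then 0 else alpha G P f i j
    A * Aᵀ + B * Bᵀ = 1 := by
  intro A B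
  ext i l
  rw [Matrix.add_apply, Matrix.mul_apply, Matrix.mul_apply, Matrix.one_apply, ← dotV_gbar G hd hP,
    ← hf.sum_dotV_mul_dotV]
  simp only [A, B, Matrix.of_apply, Matrix.transpose_apply]
  rw [sum_castLE_eq_sum_ite hk fun j => alpha G P f i j * alpha G P f l j,
    ← Finset.sum_add_distrib]
  refine Finset.sum_congr rfl fun j _ => ?_
  split_ifs <;> simp [alpha]

theorem norm_of_estimation_centers
    {V : Type} [Fintype V] [DecidableEq V] (G : SimpleGraph V) [DecidableRel G.Adj]
    (hd : ∀ v : V, 0 < G.degree v)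
    {k : ℕ} (hkn : k < Fintype.card V)
    (f : Fin (Fintype.card V) → V → ℝ) (lam : Fin (Fintype.card V) → ℝ)
    (hf : EigenData G f lam)
    (P : Fin k → Finset V) (hP : AchievesRhoAvr G P)
    (beta : Fin k → Fin k → ℝ)
    (hbeta : ∀ i : Fin k,
      f (Fin.castLE hkn.le i) = fun v => ∑ j : Fin k, beta i j * fhat G P f j v)
    (δ : ℝ) (hδ0 : 0 < δ) (hδ1 : δ ≤ 1)
    (hPsi : Psi G lam P hkn = (20 : ℝ) ^ 4 * (k : ℝ) ^ 3 / δ) :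
    ∀ i : Fin k,
      (1 - Real.sqrt δ / 4) / (vol G (P i) : ℝ) ≤
          ∑ j : Fin k, (estCenter G P beta i j) ^ 2 ∧
        ∑ j : Fin k, (estCenter G P beta i j) ^ 2 ≤
          (1 + Real.sqrt δ / 4) / (vol G (P i) : ℝ) := by
  intro i
  have hvol : (0 : ℝ) < vol G (P i) := by exact_mod_cast vol_pos G hd (hP.1.1 i)
  have hk1 : (1 : ℝ) ≤ k := by exact_mod_cast Fin.pos i
  have hk0 : (0 : ℝ) < k := by linarith
  have hcond (j : Fin k) : 0 ≤ conductance G (P j) := by unfold conductance; positivity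
  set Λ := lam ⟨k, hkn⟩ with hΛ
  set R := avgCond G P with hR
  have hPsi' : Λ / R = (20 : ℝ) ^ 4 * (k : ℝ) ^ 3 / δ := hPsi
  have hΛR : 0 < Λ / R := by rw [hPsi']; positivity
  have hR0 : 0 < R := by
    refine lt_of_le_of_ne (div_nonneg (Finset.sum_nonneg fun j _ => hcond j) hk0.le) ?_
    intro h
    rw [← h, div_zero] at hΛR
    exact lt_irrefl _ hΛR
  have hΛ0 : 0 < Λ := (div_pos_iff_of_pos_right hR0).mp hΛR
  have htail : ∑ i, ∑ j : Fin (Fintype.card V),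
      (if (j : ℕ) < k then 0 else alpha G P f i j) ^ 2 ≤ δ / 20 ^ 4 := by
    have h1 : Λ * ∑ i, ∑ j : Fin (Fintype.card V),
        (if (j : ℕ) < k then 0 else alpha G P f i j) ^ 2 ≤ k * R := by
      rw [hR, avgCond, mul_div_cancel₀ _ hk0.ne', Finset.mul_sum]
      exact Finset.sum_le_sum fun i _ => hf.lam_mul_sum_tail_le hd hkn P i
    have h2 : k * R ≤ Λ * (δ / 20 ^ 4) := by
      rw [div_eq_iff hR0.ne'] at hPsi'
      have h3 : Λ * (δ / 20 ^ 4) = k ^ 3 * R := by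
        rw [hPsi']
        field_simp
      rw [h3]
      exact mul_le_mul_of_nonneg_right (le_self_pow₀ hk1 (by norm_num)) hR0.le
    exact le_of_mul_le_mul_left (h1.trans h2) hΛ0
  obtain ⟨hlow, hup⟩ := col_sq_sum_of_left_inverse _ _ _ (δ / 20 ^ 4) (by linarith)
    (alpha_mul_transpose_add hd hf hkn.le hP.1) htail
    (beta_mul_alpha hf hkn.le P beta hbeta) i
  simp only [Matrix.of_apply] at hlow hup
  have hp : ∑ j : Fin k, (estCenter G P beta i j) ^ 2 =
      (∑ j, beta j i ^ 2) / vol G (P i) := by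
    simp only [estCenter, div_pow, Real.sq_sqrt hvol.le, Finset.sum_div]
  have hδs : δ ≤ √δ := Real.le_sqrt_of_sq_le (by nlinarith)
  rw [hp]
  refine ⟨div_le_div_of_nonneg_right ?_ hvol.le, div_le_div_of_nonneg_right ?_ hvol.le⟩
  · have := Real.sqrt_nonneg δ
    linarith
  · nlinarith

end SpectralClustering
end

section
/- If Ψ = 20^4·k^3/δ for some δ ∈ (0,1/2], then for any distinct i,j ∈ {1,…,k}, the estimation centers satisfy ‖p^{(i)} − p^{(j)}‖^2 ≥ 1/(2·min{μ(P_i), μ(P_j)}). -/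
open Finset BigOperators Matrix

namespace SpectralClustering

variable {V : Type} [Fintype V] [DecidableEq V]

/-- Bessel's inequality for a matrix with orthonormal rows. -/
theorem dotProduct_mulVec_self_le {m n : Type*} [Fintype m] [Fintype n] [DecidableEq m]
    (M : Matrix m n ℝ) (hM : M * Mᵀ = 1) (y : n → ℝ) :
    (M *ᵥ y) ⬝ᵥ (M *ᵥ y) ≤ y ⬝ᵥ y := by
  have hnonneg : 0 ≤ (y - Mᵀ *ᵥ (M *ᵥ y)) ⬝ᵥ (y - Mᵀ *ᵥ (M *ᵥ y)) :=
    Finset.sum_nonneg fun _ _ => mul_self_nonneg _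
  have hcross : y ⬝ᵥ (Mᵀ *ᵥ (M *ᵥ y)) = (M *ᵥ y) ⬝ᵥ (M *ᵥ y) := by
    rw [Matrix.dotProduct_mulVec, Matrix.vecMul_transpose]
  have hproj : (Mᵀ *ᵥ (M *ᵥ y)) ⬝ᵥ (Mᵀ *ᵥ (M *ᵥ y)) = (M *ᵥ y) ⬝ᵥ (M *ᵥ y) := by
    rw [Matrix.dotProduct_mulVec, Matrix.vecMul_transpose, Matrix.mulVec_mulVec, hM,
      Matrix.one_mulVec]
  rw [sub_dotProduct, dotProduct_sub, dotProduct_sub, hproj,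
    dotProduct_comm (Mᵀ *ᵥ (M *ᵥ y)) y, hcross] at hnonneg
  linarith

/-- If `G` has orthonormal rows, `F` has orthonormal columns and `B` is a left inverse of
`G * F`, then `B` does not decrease the Euclidean norm. -/
theorem dotProduct_self_le_mulVec {m n : Type*} [Fintype m] [Fintype n] [DecidableEq m]
    (G : Matrix m n ℝ) (F : Matrix n m ℝ) (B : Matrix m m ℝ) (hG : G * Gᵀ = 1)
    (hF : Fᵀ * F = 1) (hB : B * (G * F) = 1) (w : m → ℝ) :
    w ⬝ᵥ w ≤ (B *ᵥ w) ⬝ᵥ (B *ᵥ w) := by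
  have hw : G *ᵥ (F *ᵥ (B *ᵥ w)) = w := by
    rw [Matrix.mulVec_mulVec, Matrix.mulVec_mulVec, mul_eq_one_comm.mp hB, Matrix.one_mulVec]
  have hiso : (F *ᵥ (B *ᵥ w)) ⬝ᵥ (F *ᵥ (B *ᵥ w)) = (B *ᵥ w) ⬝ᵥ (B *ᵥ w) := by
    rw [Matrix.dotProduct_mulVec, ← Matrix.mulVec_transpose, Matrix.mulVec_mulVec, hF,
      Matrix.one_mulVec]
  have hbessel := dotProduct_mulVec_self_le G hG (F *ᵥ (B *ᵥ w))
  rwa [hw, hiso] at hbessel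

theorem gbar_mul_transpose (G : SimpleGraph V) [DecidableRel G.Adj]
    {k : ℕ} (P : Fin k → Finset V) (hvol : ∀ i, 0 < vol G (P i))
    (hdisj : ∀ i j, i ≠ j → Disjoint (P i) (P j)) :
    Matrix.of (gbar G P) * (Matrix.of (gbar G P))ᵀ = 1 := by
  ext i j
  simp only [Matrix.mul_apply, Matrix.transpose_apply, Matrix.of_apply, Matrix.one_apply, gbar]
  split_ifs with hij
  · subst hij
    have hpos : (0 : ℝ) < vol G (P i) := by exact_mod_cast hvol i
    have hterm : ∀ v, (if v ∈ P i then Real.sqrt (G.degree v) else 0) / Real.sqrt (vol G (P i)) *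
        ((if v ∈ P i then Real.sqrt (G.degree v) else 0) / Real.sqrt (vol G (P i))) =
        (if v ∈ P i then (G.degree v : ℝ) else 0) / vol G (P i) := by
      intro v
      rw [div_mul_div_comm, Real.mul_self_sqrt hpos.le]
      split_ifs
      · rw [Real.mul_self_sqrt (Nat.cast_nonneg _)]
      · simp
    rw [Finset.sum_congr rfl fun v _ => hterm v, ← Finset.sum_div, Finset.sum_ite_mem,
      Finset.univ_inter, div_eq_one_iff_eq hpos.ne']
    simp [vol]
  · refine Finset.sum_eq_zero fun v _ => ?_
    by_cases hv : v ∈ P i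
    · simp [Finset.disjoint_left.mp (hdisj i j hij) hv]
    · simp [hv]

theorem fhat_eq_sum_fin (G : SimpleGraph V) [DecidableRel G.Adj] {k : ℕ}
    (hk : k ≤ Fintype.card V) (P : Fin k → Finset V) (f : Fin (Fintype.card V) → V → ℝ)
    (i : Fin k) (v : V) :
    fhat G P f i v =
      ∑ l : Fin k, alpha G P f i (Fin.castLE hk l) * f (Fin.castLE hk l) v := by
  rw [fhat, ← Finset.sum_filter]
  symm
  refine Finset.sum_bij (fun l _ => Fin.castLE hk l) ?_ ?_ ?_ ?_
  · simp
  · intro a _ b _ hab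
    exact Fin.castLE_injective hk hab
  · intro b hb
    exact ⟨⟨b, (Finset.mem_filter.mp hb).2⟩, Finset.mem_univ _, rfl⟩
  · simp

theorem estimation_centers_well_spread
    {V : Type} [Fintype V] [DecidableEq V] (G : SimpleGraph V) [DecidableRel G.Adj]
    (hd : ∀ v : V, 0 < G.degree v)
    {k : ℕ} (hkn : k < Fintype.card V)
    (f : Fin (Fintype.card V) → V → ℝ) (lam : Fin (Fintype.card V) → ℝ)
    (hf : EigenData G f lam)
    (P : Fin k → Finset V) (hP : AchievesRhoAvr G P)
    (beta : Fin k → Fin k → ℝ)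
    (hbeta : ∀ i : Fin k,
      f (Fin.castLE hkn.le i) = fun v => ∑ j : Fin k, beta i j * fhat G P f j v)
    (δ : ℝ) (hδ0 : 0 < δ) (hδ1 : δ ≤ 1 / 2)
    (hPsi : Psi G lam P hkn = (20 : ℝ) ^ 4 * (k : ℝ) ^ 3 / δ) :
    ∀ i j : Fin k, i ≠ j →
      ∑ l : Fin k, (estCenter G P beta i l - estCenter G P beta j l) ^ 2 ≥
        1 / (2 * min ((vol G (P i) : ℝ)) ((vol G (P j) : ℝ))) := by
  intro i j hij
  obtain ⟨⟨hne, hdisj, -⟩, -⟩ := hP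
  have hvol : ∀ l, 0 < vol G (P l) := fun l => vol_pos G hd (hne l)
  set F : Matrix V (Fin k) ℝ := Matrix.of fun v l => f (Fin.castLE hkn.le l) v with hFdef
  have hF : Fᵀ * F = 1 := by
    ext a b
    simpa [Matrix.mul_apply, Matrix.one_apply, dotV, F] using
      hf.ortho (Fin.castLE hkn.le a) (Fin.castLE hkn.le b)
  have hBF : Matrix.of beta * (Matrix.of (gbar G P) * F) * Fᵀ = Fᵀ := by
    rw [Matrix.mul_assoc]
    ext a v
    simp only [Matrix.transpose_apply]
    rw [show F v a = f (Fin.castLE hkn.le a) v from rfl, hbeta a, Matrix.mul_apply]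
    refine Finset.sum_congr rfl fun b _ => ?_
    rw [fhat_eq_sum_fin G hkn.le]
    rfl
  have hB : Matrix.of beta * (Matrix.of (gbar G P) * F) = 1 := by
    have h := congrArg (· * F) hBF
    simpa only [Matrix.mul_assoc _ Fᵀ F, hF, Matrix.mul_one] using h
  have hi : (0 : ℝ) < vol G (P i) := by exact_mod_cast hvol i
  have hj : (0 : ℝ) < vol G (P j) := by exact_mod_cast hvol j
  set w : Fin k → ℝ := Pi.single i (Real.sqrt (vol G (P i)))⁻¹ -
    Pi.single j (Real.sqrt (vol G (P j)))⁻¹ with hw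
  have hww : w ⬝ᵥ w = (vol G (P i) : ℝ)⁻¹ + (vol G (P j) : ℝ)⁻¹ := by
    simp [hw, hij, hij.symm, ← mul_inv, Real.mul_self_sqrt]
  have hBw : (Matrix.of beta *ᵥ w) ⬝ᵥ (Matrix.of beta *ᵥ w) =
      ∑ l : Fin k, (estCenter G P beta i l - estCenter G P beta j l) ^ 2 := by
    refine Finset.sum_congr rfl fun l _ => ?_
    simp [hw, Matrix.mulVec_sub, estCenter, div_eq_mul_inv, sq]
  have hspread := dotProduct_self_le_mulVec _ F _
    (gbar_mul_transpose G P hvol hdisj) hF hB w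
  rw [hBw, hww] at hspread
  refine le_trans ?_ hspread
  have hmin : (0 : ℝ) < min (vol G (P i) : ℝ) (vol G (P j)) := lt_min hi hj
  calc 1 / (2 * min (vol G (P i) : ℝ) (vol G (P j)))
      ≤ (min (vol G (P i) : ℝ) (vol G (P j)))⁻¹ := by
        rw [one_div]
        exact inv_anti₀ hmin (by linarith)
    _ ≤ (vol G (P i) : ℝ)⁻¹ + (vol G (P j) : ℝ)⁻¹ := by
        have := inv_pos.mpr hi
        have := inv_pos.mpr hj
        rcases min_choice (vol G (P i) : ℝ) (vol G (P j)) with h | h <;> rw [h] <;> linarith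

end SpectralClustering
end
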